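/- There exists a constant c > 0 such that for every ε ∈ (0,1], every integer p ≥ 1, and every real polynomial q in one variable of degree at most p, there exists a twice continuously differentiable function v : ℝ² → ℝ satisfying: (i) v(x,0) = x(1 − x)·q(x) for all x ∈ [0,1]; (ii) ∫_T v² ≤ c · ε · ∫_0^1 q(x)² dx; (iii) ∫_T ((∂_x v)² + (∂_y v)²) ≤ c · (ε·p⁴ + ε^{−1}) · ∫_0^1 q(x)² dx; (iv) ∫_T ((∂_{xx} v)² + 2(∂_{xy} v)² + (∂_{yy} v)²) ≤ c · (ε·p⁸ + ε^{−3} + ε^{−1}·p⁴) · ∫_0^1 q(x)² dx; where T = {(x,y) ∈ ℝ² : x ≥ 0, y ≥ 0, x + y ≤ 1}. -/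

import Mathlib

open MeasureTheory

/-- The reference triangle `T = {(x,y) : x ≥ 0, y ≥ 0, x + y ≤ 1}`. -/
def refTriangle : Set (ℝ × ℝ) := {z | 0 ≤ z.1 ∧ 0 ≤ z.2 ∧ z.1 + z.2 ≤ 1}

/-- Partial derivative in the `x` direction. -/
noncomputable def dx (v : ℝ × ℝ → ℝ) (z : ℝ × ℝ) : ℝ := fderiv ℝ v z (1, 0)

/-- Partial derivative in the `y` direction. -/
noncomputable def dy (v : ℝ × ℝ → ℝ) (z : ℝ × ℝ) : ℝ := fderiv ℝ v z (0, 1)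

open Polynomial

namespace ExtStab

/-- The integral over `[0,1]` of a real polynomial, as a linear functional. -/
noncomputable def I : ℝ[X] →ₗ[ℝ] ℝ where
  toFun f := ∫ x in (0:ℝ)..1, f.eval x
  map_add' f g := by
    simp only [eval_add]
    exact intervalIntegral.integral_add (f.continuous.intervalIntegrable _ _)
      (g.continuous.intervalIntegrable _ _)
  map_smul' a f := by
    simp only [eval_smul, smul_eq_mul, RingHom.id_apply]
    exact intervalIntegral.integral_const_mul _ _

lemma I_apply (f : ℝ[X]) : I f = ∫ x in (0:ℝ)..1, f.eval x := rfl

lemma I_C_mul (a : ℝ) (f : ℝ[X]) : I (C a * f) = a * I f := by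
  rw [← smul_eq_C_mul, map_smul, smul_eq_mul]

lemma I_deriv (f : ℝ[X]) : I (derivative f) = f.eval 1 - f.eval 0 := by
  rw [I_apply]
  exact intervalIntegral.integral_eq_sub_of_hasDerivAt (fun x _ => f.hasDerivAt x)
    ((derivative f).continuous.intervalIntegrable _ _)

lemma I_sq_nonneg (f : ℝ[X]) : 0 ≤ I (f * f) := by
  rw [I_apply]
  apply intervalIntegral.integral_nonneg (by norm_num)
  intro x _
  rw [eval_mul]; exact mul_self_nonneg _

lemma eq_zero_of_I_sq (f : ℝ[X]) (h : I (f * f) = 0) : f = 0 := by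
  by_contra hf
  have hne : {x : ℝ | f.eval x = 0}.Finite := by
    have := f.finite_setOfPred_isRoot hf
    exact this
  obtain ⟨x, hx, hx0⟩ : ∃ x ∈ Set.Ioo (0:ℝ) 1, f.eval x ≠ 0 := by
    by_contra hcon
    push Not at hcon
    exact (Set.Ioo_infinite (by norm_num : (0:ℝ) < 1)) (hne.subset hcon)
  have : 0 < ∫ x in (0:ℝ)..1, (f * f).eval x := by
    apply intervalIntegral.integral_pos (by norm_num) (f * f).continuous.continuousOn
    · intro x _
      rw [eval_mul]; exact mul_self_nonneg _
    · exact ⟨x, ⟨hx.1.le, hx.2.le⟩, by rw [eval_mul]; exact mul_self_pos.2 hx0⟩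
  rw [I_apply] at h
  linarith

/-- Vanishing coefficients from index `n` on. -/
def Low (n : ℕ) (f : ℝ[X]) : Prop := ∀ m, n ≤ m → f.coeff m = 0

lemma orth_of_monomials (n : ℕ) (P : ℝ[X]) (h : ∀ i < n, I (P * X ^ i) = 0) (r : ℝ[X])
    (hr : Low n r) : I (P * r) = 0 := by
  have hd : r.degree < n := (degree_lt_iff_coeff_zero _ _).2 hr
  have : r = ∑ i ∈ Finset.range n, C (r.coeff i) * X ^ i := by
    ext m
    simp only [finsetSum_coeff, coeff_C_mul, coeff_X_pow, mul_ite, mul_one, mul_zero]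
    rw [Finset.sum_ite_eq]
    split_ifs with hm
    · rfl
    · exact hr m (by simpa using hm)
  rw [this, Finset.mul_sum, map_sum]
  apply Finset.sum_eq_zero
  intro i hi
  rw [show P * (C (r.coeff i) * X ^ i) = C (r.coeff i) * (P * X ^ i) by ring, I_C_mul,
    h i (by simpa using hi), mul_zero]

/-- Existence of the Legendre polynomial. -/
lemma exists_legendre (n : ℕ) : ∃ P : ℝ[X], Low (n+1) P ∧ P.coeff n ≠ 0 ∧
    ∀ r, Low n r → I (P * r) = 0 := by
  let φ : degreeLT ℝ (n+1) →ₗ[ℝ] (Fin n → ℝ) :=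
    LinearMap.pi fun i => I ∘ₗ (LinearMap.mulRight ℝ ((X:ℝ[X]) ^ (i:ℕ))) ∘ₗ (degreeLT ℝ (n+1)).subtype
  have : FiniteDimensional ℝ (degreeLT ℝ (n+1)) :=
    Module.Finite.equiv (degreeLTEquiv ℝ (n+1)).symm
  have hker : LinearMap.ker φ ≠ ⊥ := by
    apply LinearMap.ker_ne_bot_of_finrank_lt
    rw [LinearEquiv.finrank_eq (degreeLTEquiv ℝ (n+1))]
    simp
  obtain ⟨⟨P, hP⟩, hPk, hP0⟩ := Submodule.exists_mem_ne_zero_of_ne_bot hker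
  have horth : ∀ r, Low n r → I (P * r) = 0 := by
    apply orth_of_monomials
    intro i hi
    have := congrFun (LinearMap.mem_ker.1 hPk) ⟨i, hi⟩
    simpa [φ] using this
  have hlow : Low (n+1) P := by
    rw [mem_degreeLT] at hP
    exact (degree_lt_iff_coeff_zero _ _).1 hP
  refine ⟨P, hlow, ?_, horth⟩
  intro h0
  apply hP0
  have : Low n P := by
    intro m hm
    rcases hm.eq_or_lt with rfl | h
    · exact h0
    · exact hlow m h
  have := eq_zero_of_I_sq P (horth P this)
  simpa using this

lemma coeff_L (f : ℝ[X]) (m : ℕ) : (derivative ((X - X^2) * derivative f)).coeff m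
    = (m+1) * ((m+1) * f.coeff (m+1) - m * f.coeff m) := by
  rw [coeff_derivative, sub_mul, coeff_sub, coeff_X_mul, pow_two, mul_assoc, coeff_X_mul,
    coeff_derivative]
  rcases m with _ | m
  · simp
  · rw [coeff_X_mul, coeff_derivative]; push_cast; ring

lemma Low.sub {n f g} (hf : Low n f) (hg : Low n g) : Low n (f - g) := by
  intro m hm; rw [coeff_sub, hf m hm, hg m hm, sub_zero]

/-- Symmetry of the Legendre operator. -/
lemma L_symm (f g : ℝ[X]) : I (derivative ((X - X^2) * derivative f) * g)
    = I (f * derivative ((X - X^2) * derivative g)) := by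
  have h := I_deriv ((X - X^2) * derivative f * g - f * ((X - X^2) * derivative g))
  have e : derivative ((X - X^2) * derivative f * g - f * ((X - X^2) * derivative g))
    = derivative ((X - X^2) * derivative f) * g - f * derivative ((X - X^2) * derivative g) := by
    rw [derivative_sub, derivative_mul (f := (X - X^2) * derivative f), derivative_mul (f := f)]
    ring
  rw [e, map_sub] at h
  simp only [eval_sub, eval_mul, eval_X, eval_pow] at h
  linarith

lemma legendre_ode (n : ℕ) (P : ℝ[X]) (hl : Low (n+1) P)
    (ho : ∀ r, Low n r → I (P * r) = 0) :
    derivative ((X - X^2) * derivative P) = C (-(n*(n+1):ℝ)) * P := by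
  set R := derivative ((X - X^2) * derivative P) - C (-(n*(n+1):ℝ)) * P with hR
  have hRl : Low n R := by
    intro m hm
    rw [hR, coeff_sub, coeff_L, coeff_C_mul, hl (m+1) (by omega)]
    rcases hm.eq_or_lt with rfl | h
    · ring
    · rw [hl m h]; ring
  have hz : I (R * R) = 0 := by
    have h1 : R * R = derivative ((X - X^2) * derivative P) * R - C (-(n*(n+1):ℝ)) * (P * R) := by
      conv_lhs => rw [hR]
      rw [← hR]; ring
    rw [h1, map_sub, I_C_mul, ho R hRl, L_symm, ho]
    · ring
    · intro m hm
      rw [coeff_L, hRl m hm, hRl (m+1) (by omega)]; ring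
  exact sub_eq_zero.1 (eq_zero_of_I_sq R hz)

lemma legendre_deriv (n : ℕ) (P : ℝ[X]) (hl : Low (n+1) P)
    (ho : ∀ r, Low n r → I (P * r) = 0) :
    I (derivative P * derivative P) = 2*n*(n+1)*(2*n+1) * I (P * P) := by
  have ode := legendre_ode n P hl ho
  have ode' : (1 - 2 * X) * derivative P + (X - X^2) * derivative (derivative P)
      = C (-(n*(n+1):ℝ)) * P := by
    rw [← ode, derivative_mul (f := X - X^2)]
    simp only [derivative_sub, derivative_X, derivative_X_sq, C_ofNat]
  have e1 := congrArg (eval 1) ode'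
  have e0 := congrArg (eval 0) ode'
  simp at e1 e0
  have hX : I (P * (X * derivative P)) = n * I (P * P) := by
    have hs : Low n (X * derivative P - C (n:ℝ) * P) := by
      intro m hm
      rw [coeff_sub, coeff_C_mul]
      have : (X * derivative P).coeff m = m * P.coeff m := by
        rcases m with _ | m
        · simp
        · rw [coeff_X_mul, coeff_derivative]; push_cast; ring
      rw [this]
      rcases hm.eq_or_lt with rfl | h
      · ring
      · rw [hl m h]; ring
    have := ho _ hs
    rw [show P * (X * derivative P - C (n:ℝ) * P) = P * (X * derivative P) - C (n:ℝ) * (P * P) by ring,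
      map_sub, I_C_mul] at this
    linarith
  have hD : I (P * derivative P) = 0 := by
    apply ho
    intro m hm
    rw [coeff_derivative, hl (m+1) (by omega)]; ring
  have hDD : I (P * derivative (derivative P)) = 0 := by
    apply ho
    intro m hm
    rw [coeff_derivative, coeff_derivative, hl (m+1+1) (by omega)]; ring
  have b1 := I_deriv (X * (P * P))
  rw [show derivative (X * (P * P)) = P * P + C 2 * (P * (X * derivative P)) by
    simp only [derivative_mul, derivative_X, C_ofNat]; ring, map_add, I_C_mul, hX] at b1
  have b0 := I_deriv (P * P)
  rw [show derivative (P * P) = C 2 * (P * derivative P) by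
    simp only [derivative_mul, C_ofNat]; ring, I_C_mul, hD] at b0
  have b2 := I_deriv (P * derivative P)
  rw [show derivative (P * derivative P) = derivative P * derivative P + P * derivative (derivative P) by
    simp only [derivative_mul], map_add, hDD] at b2
  simp at b1 b0 b2
  set A := eval 1 P
  set B := eval 0 P
  set A' := eval 1 (derivative P)
  set B' := eval 0 (derivative P)
  have hA' : A' = n*(n+1)*A := by linarith
  have hB' : B' = -(n*(n+1)*B) := by linarith
  have hBB : B * B = A * A := by linarith
  rw [hA', hB'] at b2
  have : I (derivative P * derivative P) = n*(n+1)*(A*A) + n*(n+1)*(B*B) := by linarith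
  rw [this, hBB, ← b1]; ring

/-- Markov inequality in `L²(0,1)`. -/
lemma markov (p : ℕ) : ∀ q : ℝ[X], Low (p+1) q →
    I (derivative q * derivative q) ≤ p*(p+1)^2*(p+2) * I (q * q) := by
  induction p with
  | zero =>
    intro q hq
    have : derivative q = 0 := by
      ext m; rw [coeff_derivative, hq (m+1) (by omega)]; simp
    rw [this]; simp
  | succ k ih =>
    intro q hq
    obtain ⟨P, hl, hn, ho⟩ := exists_legendre (k+1)
    set a := q.coeff (k+1) / P.coeff (k+1) with ha
    set r := q - C a * P with hr
    have hrl : Low (k+1) r := by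
      intro m hm
      rw [hr, coeff_sub, coeff_C_mul]
      rcases hm.eq_or_lt with rfl | h
      · rw [ha]; field_simp; ring
      · rw [hl m h, hq m h]; ring
    have hqr : q = r + C a * P := by rw [hr]; ring
    have hR := ih r hrl
    have hPd := legendre_deriv (k+1) P hl ho
    have hor := ho r hrl
    have hq2 : I (q * q) = I (r * r) + a^2 * I (P * P) := by
      rw [hqr, show (r + C a * P) * (r + C a * P) = r * r + C (2*a) * (P * r) + C (a^2) * (P*P) by
        simp only [C_mul, C_pow, C_ofNat]; ring, map_add, map_add, I_C_mul, I_C_mul, hor]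
      ring
    have hq'2 : I (derivative q * derivative q) = I (derivative r * derivative r)
        + 2 * a * I (derivative r * derivative P) + a^2 * I (derivative P * derivative P) := by
      rw [hqr, derivative_add, derivative_C_mul,
        show (derivative r + C a * derivative P) * (derivative r + C a * derivative P)
         = derivative r * derivative r + C (2*a) * (derivative r * derivative P)
          + C (a^2) * (derivative P * derivative P) by
        simp only [C_mul, C_pow, C_ofNat]; ring, map_add, map_add, I_C_mul, I_C_mul]
    have hnr := I_sq_nonneg r
    have hnP := I_sq_nonneg P
    rw [hq'2, hq2, hPd]
    push_cast at *
    rcases Nat.eq_zero_or_pos k with rfl | hk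
    · have : derivative r = 0 := by
        ext m; rw [coeff_derivative, hrl (m+1) (by omega)]; simp
      rw [this]; simp
      nlinarith [mul_nonneg (sq_nonneg a) hnP]
    · have hk' : (1:ℝ) ≤ k := by exact_mod_cast hk
      set c : ℝ := k*(k+1)^2*(k+2) with hc
      set d : ℝ := 2*(k+1)*(k+1+1)*(2*(k+1)+1) with hd
      have hcp : 0 < c := by positivity
      have hdp : 0 < d := by positivity
      have hcd : ((k:ℝ)+1)*(k+1+1)^2*(k+1+2) = c + d := by rw [hc, hd]; ring
      rw [hcd]
      have key := I_sq_nonneg (C d * derivative r - C (c * a) * derivative P)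
      rw [show (C d * derivative r - C (c * a) * derivative P) * (C d * derivative r - C (c * a) * derivative P)
         = C (d^2) * (derivative r * derivative r) - C (2 * d * c * a) * (derivative r * derivative P)
          + C (c^2*a^2) * (derivative P * derivative P) by
        simp only [C_mul, C_pow, C_ofNat]; ring, map_add, map_sub, I_C_mul, I_C_mul, I_C_mul, hPd] at key
      have h1 : d^2 * I (derivative r * derivative r) ≤ d^2 * (c * I (r*r)) :=
        mul_le_mul_of_nonneg_left hR (sq_nonneg d)
      have h2 : c * d * (2 * a * I (derivative r * derivative P))
          ≤ c * d * (d * I (r*r) + c * (a^2 * I (P*P))) := by nlinarith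
      have h3 := le_of_mul_le_mul_left h2 (mul_pos hcp hdp)
      nlinarith

/-- Separated functions. -/
noncomputable def V (ε : ℝ) (a : ℝ[X]) (k : ℝ) : ℝ × ℝ → ℝ :=
  fun z => k * a.eval z.1 * Real.exp (-ε⁻¹ * z.2)

lemma V_contDiff (ε : ℝ) (a : ℝ[X]) (k : ℝ) : ContDiff ℝ 2 (V ε a k) := by
  unfold V
  have : ContDiff ℝ 2 (fun x : ℝ => a.eval x) := by
    simpa using (Polynomial.contDiff_aeval (𝕜 := ℝ) a 2)
  fun_prop

lemma V_hasFDerivAt (ε : ℝ) (a : ℝ[X]) (k : ℝ) (z : ℝ × ℝ) :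
    HasFDerivAt (V ε a k) ((k * a.eval z.1) • (Real.exp (-ε⁻¹ * z.2) • ((-ε⁻¹) • ContinuousLinearMap.snd ℝ ℝ ℝ))
      + (Real.exp (-ε⁻¹ * z.2)) • (k • ((derivative a).eval z.1 • ContinuousLinearMap.fst ℝ ℝ ℝ))) z := by
  have h1 : HasFDerivAt (fun z : ℝ × ℝ => a.eval z.1)
      ((derivative a).eval z.1 • ContinuousLinearMap.fst ℝ ℝ ℝ) z :=
    (a.hasDerivAt z.1).comp_hasFDerivAt z hasFDerivAt_fst
  have h2 : HasFDerivAt (fun z : ℝ × ℝ => Real.exp (-ε⁻¹ * z.2))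
      (Real.exp (-ε⁻¹ * z.2) • ((-ε⁻¹) • ContinuousLinearMap.snd ℝ ℝ ℝ)) z :=
    (hasFDerivAt_snd.const_mul (-ε⁻¹)).exp
  exact (h1.const_mul k).mul h2

lemma dx_V (ε : ℝ) (a : ℝ[X]) (k : ℝ) : dx (V ε a k) = V ε (derivative a) k := by
  funext z
  unfold dx
  rw [(V_hasFDerivAt ε a k z).fderiv]
  simp [V]; ring

lemma dy_V (ε : ℝ) (a : ℝ[X]) (k : ℝ) : dy (V ε a k) = V ε a (-ε⁻¹ * k) := by
  funext z
  unfold dy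
  rw [(V_hasFDerivAt ε a k z).fderiv]
  simp [V]; ring

lemma tri_sub : refTriangle ⊆ Set.Icc (0:ℝ) 1 ×ˢ Set.Icc (0:ℝ) 1 := by
  rintro ⟨x, y⟩ ⟨h1, h2, h3⟩
  simp only at h1 h2 h3
  exact ⟨⟨h1, by simp only; linarith⟩, ⟨h2, by simp only; linarith⟩⟩

lemma V_sq_int (ε : ℝ) (a : ℝ[X]) (k : ℝ) :
    IntegrableOn (fun z => (V ε a k z)^2) (Set.Icc (0:ℝ) 1 ×ˢ Set.Icc (0:ℝ) 1) := by
  apply ContinuousOn.integrableOn_compact (isCompact_Icc.prod isCompact_Icc)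
  exact ((V_contDiff ε a k).continuous.pow 2).continuousOn

lemma V_sq_int' (ε : ℝ) (a : ℝ[X]) (k : ℝ) :
    IntegrableOn (fun z => (V ε a k z)^2) refTriangle := (V_sq_int ε a k).mono_set tri_sub

lemma I_eq (a : ℝ[X]) : ∫ x in Set.Icc (0 : ℝ) 1, (a.eval x) ^ 2 = I (a * a) := by
  rw [I_apply, integral_Icc_eq_integral_Ioc, intervalIntegral.integral_of_le (by norm_num)]
  congr 1; funext x; rw [eval_mul]; ring

lemma exp_int (ε : ℝ) (h : 0 < ε) :
    ∫ y in Set.Icc (0 : ℝ) 1, (Real.exp (-ε⁻¹ * y))^2 ≤ ε := by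
  rw [integral_Icc_eq_integral_Ioc, ← intervalIntegral.integral_of_le (by norm_num)]
  have hd : ∀ y ∈ Set.uIcc (0:ℝ) 1, HasDerivAt (fun y => -(ε/2) * (Real.exp (-ε⁻¹ * y))^2)
      ((Real.exp (-ε⁻¹ * y))^2) y := by
    intro y _
    have h1 : HasDerivAt (fun y : ℝ => -ε⁻¹ * y) (-ε⁻¹ * 1) y := (hasDerivAt_id y).const_mul _
    have h2 := (h1.exp.pow 2).const_mul (-(ε/2))
    refine h2.congr_deriv ?_
    have hne : ε * ε⁻¹ = 1 := mul_inv_cancel₀ h.ne'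
    norm_num
    linear_combination (Real.exp (-(ε⁻¹ * y)))^2 * hne
  rw [intervalIntegral.integral_eq_sub_of_hasDerivAt hd
    ((by fun_prop : Continuous fun y => (Real.exp (-ε⁻¹ * y))^2).intervalIntegrable _ _)]
  simp only [mul_zero, Real.exp_zero]
  nlinarith [mul_nonneg h.le (sq_nonneg (Real.exp (-ε⁻¹ * 1)))]

lemma V_bound (ε : ℝ) (h : 0 < ε) (a : ℝ[X]) (k : ℝ) :
    ∫ z in refTriangle, (V ε a k z)^2 ≤ k^2 * ε * I (a * a) := by
  have h1 : ∫ z in refTriangle, (V ε a k z)^2 ≤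
      ∫ z in Set.Icc (0:ℝ) 1 ×ˢ Set.Icc (0:ℝ) 1, (V ε a k z)^2 :=
    setIntegral_mono_set (V_sq_int ε a k) (Filter.Eventually.of_forall fun z => sq_nonneg _)
      tri_sub.eventuallyLE
  have h2 : ∫ z in Set.Icc (0:ℝ) 1 ×ˢ Set.Icc (0:ℝ) 1, (V ε a k z)^2 =
      (∫ x in Set.Icc (0:ℝ) 1, k^2 * (a.eval x)^2) *
        ∫ y in Set.Icc (0 : ℝ) 1, (Real.exp (-ε⁻¹ * y))^2 := by
    rw [← setIntegral_prod_mul]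
    congr 1; funext z; simp only [V]; ring
  rw [h2, integral_const_mul, I_eq] at h1
  have h3 := mul_le_mul_of_nonneg_left (exp_int ε h) (mul_nonneg (sq_nonneg k) (I_sq_nonneg a))
  linarith

lemma low_mono {n m : ℕ} {f : ℝ[X]} (h : n ≤ m) (hf : Low n f) : Low m f :=
  fun i hi => hf i (h.trans hi)

end ExtStab

/-- ε-weighted $hp$-explicit polynomial extension stability
result on the reference triangle (Proposition 3.8 of the paper, squared form,
triangle case, where the trace of the extension on the bottom edge is the
face bubble `x(1-x)` times `q`). -/
theorem extension_stability_triangle :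
    ∃ c : ℝ, 0 < c ∧
      ∀ ε : ℝ, ε ∈ Set.Ioc (0 : ℝ) 1 → ∀ p : ℕ, 1 ≤ p →
        ∀ q : Polynomial ℝ, q.natDegree ≤ p →
          ∃ v : ℝ × ℝ → ℝ, ContDiff ℝ 2 v ∧
            (∀ x ∈ Set.Icc (0 : ℝ) 1, v (x, 0) = x * (1 - x) * q.eval x) ∧
            ((∫ z in refTriangle, (v z) ^ 2) ≤
              c * ε * ∫ x in Set.Icc (0 : ℝ) 1, (q.eval x) ^ 2) ∧
            ((∫ z in refTriangle, ((dx v z) ^ 2 + (dy v z) ^ 2)) ≤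
              c * (ε * (p : ℝ) ^ 4 + ε⁻¹) *
                ∫ x in Set.Icc (0 : ℝ) 1, (q.eval x) ^ 2) ∧
            ((∫ z in refTriangle,
                ((dx (dx v) z) ^ 2 + 2 * (dx (dy v) z) ^ 2 + (dy (dy v) z) ^ 2)) ≤
              c * (ε * (p : ℝ) ^ 8 + ε ^ (-3 : ℤ) + ε⁻¹ * (p : ℝ) ^ 4) *
                ∫ x in Set.Icc (0 : ℝ) 1, (q.eval x) ^ 2) := by
  refine ⟨57600, by norm_num, ?_⟩
  intro ε hε p hp q hq
  obtain ⟨he, he1⟩ := hε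
  rw [ExtStab.I_eq]
  set w : ℝ[X] := X * (1 - X) * q with hw
  have hp' : (1:ℝ) ≤ p := by exact_mod_cast hp
  have hwl : ExtStab.Low (p+2+1) w := by
    intro m hm
    apply coeff_eq_zero_of_natDegree_lt
    have h1 : w.natDegree ≤ (1 + 1) + p := by
      apply natDegree_mul_le_of_le _ hq
      apply natDegree_mul_le_of_le natDegree_X_le
      apply (natDegree_sub_le _ _).trans
      simp
    omega
  have hwl' : ExtStab.Low (p+2+1) (derivative w) := by
    intro m hm
    rw [coeff_derivative, hwl (m+1) (by omega), zero_mul]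
  have m1 := ExtStab.markov (p+2) w hwl
  have m2 := ExtStab.markov (p+2) (derivative w) hwl'
  have hww : ExtStab.I (w * w) ≤ ExtStab.I (q * q) := by
    rw [ExtStab.I_apply, ExtStab.I_apply]
    apply intervalIntegral.integral_mono_on (by norm_num)
      ((w*w).continuous.intervalIntegrable _ _) ((q*q).continuous.intervalIntegrable _ _)
    intro x hx
    obtain ⟨hx0, hx1⟩ := hx
    rw [hw]
    simp only [eval_mul, eval_X, eval_sub, eval_one]
    have a0 : 0 ≤ x * (1 - x) := mul_nonneg hx0 (by linarith)
    have a1 : x * (1 - x) ≤ 1 := by nlinarith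
    have a2 : (x * (1 - x)) ^ 2 ≤ 1 := by nlinarith
    nlinarith [mul_le_mul_of_nonneg_right a2 (mul_self_nonneg (q.eval x))]
  set N := ExtStab.I (q * q)
  have hN : 0 ≤ N := ExtStab.I_sq_nonneg q
  have hW0 := ExtStab.I_sq_nonneg w
  have hW1 := ExtStab.I_sq_nonneg (derivative w)
  set W0 := ExtStab.I (w * w)
  set W1 := ExtStab.I (derivative w * derivative w)
  set W2 := ExtStab.I (derivative (derivative w) * derivative (derivative w))
  push_cast at m1 m2
  have hM : ((p:ℝ)+2)*(p+2+1)^2*(p+2+2) ≤ 240 * (p:ℝ)^4 := by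
    have : ((p:ℝ)+2)*(p+2+1)^2*(p+2+2) ≤ (3*p) * (4*p)^2 * (5*p) := by
      gcongr <;> linarith
    nlinarith
  have b1 : W1 ≤ 240 * (p:ℝ)^4 * N :=
    m1.trans (mul_le_mul hM hww hW0 (by positivity))
  have b2 : W2 ≤ 57600 * (p:ℝ)^8 * N := by
    have := m2.trans (mul_le_mul hM b1 hW1 (by positivity))
    calc W2 ≤ _ := this
      _ = _ := by ring
  have hi : 0 < ε⁻¹ := inv_pos.2 he
  refine ⟨ExtStab.V ε w 1, ExtStab.V_contDiff _ _ _, ?_, ?_, ?_, ?_⟩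
  · intro x _
    simp [ExtStab.V, hw]
  · have := ExtStab.V_bound ε he w 1
    have h2 := mul_le_mul_of_nonneg_left hww he.le
    have h3 := mul_nonneg he.le hN
    linarith
  · rw [ExtStab.dx_V, ExtStab.dy_V,
      integral_add (ExtStab.V_sq_int' _ _ _) (ExtStab.V_sq_int' _ _ _)]
    have h1 := ExtStab.V_bound ε he (derivative w) 1
    have h2 := ExtStab.V_bound ε he w (-ε⁻¹ * 1)
    rw [show (-ε⁻¹ * 1)^2 * ε = ε⁻¹ by field_simp] at h2
    have h3 := mul_le_mul_of_nonneg_left b1 he.le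
    have h4 := mul_le_mul_of_nonneg_left hww hi.le
    have h5 : 0 ≤ ε * (p:ℝ)^4 * N := by positivity
    have h6 : 0 ≤ ε⁻¹ * N := by positivity
    nlinarith
  · have hz : ε ^ (-3 : ℤ) = ε⁻¹ ^ 3 := by
      rw [zpow_neg, inv_pow]; norm_cast
    rw [hz]
    simp only [ExtStab.dx_V, ExtStab.dy_V]
    have hint : Integrable (fun z => ExtStab.V ε (derivative (derivative w)) 1 z ^ 2 +
        2 * ExtStab.V ε (derivative w) (-ε⁻¹ * 1) z ^ 2) (volume.restrict refTriangle) :=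
      (ExtStab.V_sq_int' _ _ _).add ((ExtStab.V_sq_int' _ _ _).const_mul 2)
    rw [integral_add hint (ExtStab.V_sq_int' _ _ _),
      integral_add (ExtStab.V_sq_int' _ _ _) ((ExtStab.V_sq_int' _ _ _).const_mul 2),
      integral_const_mul]
    have h0 := ExtStab.V_bound ε he (derivative (derivative w)) 1
    have h1 := ExtStab.V_bound ε he (derivative w) (-ε⁻¹ * 1)
    have h2 := ExtStab.V_bound ε he w (-ε⁻¹ * (-ε⁻¹ * 1))
    rw [show (-ε⁻¹ * 1)^2 * ε = ε⁻¹ by field_simp] at h1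
    rw [show (-ε⁻¹ * (-ε⁻¹ * 1))^2 * ε = ε⁻¹ ^ 3 by field_simp] at h2
    have h3 := mul_le_mul_of_nonneg_left b2 he.le
    have h4 := mul_le_mul_of_nonneg_left b1 hi.le
    have h5 := mul_le_mul_of_nonneg_left hww (pow_pos hi 3).le
    have h6 : 0 ≤ ε * (p:ℝ)^8 * N := by positivity
    have h7 : 0 ≤ ε⁻¹ * (p:ℝ)^4 * N := by positivity
    have h8 : 0 ≤ ε⁻¹ ^ 3 * N := by positivity
    nlinarith
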